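/- arXiv:1105.2082 — 7 statements merged into one kernel-verified Lean document; each statement's English description precedes it below -/
import Mathlib

section
/- Let q, n ≥ 0 and suppose μ ∈ V_{q+n} satisfies conditions (h1), (h3) and (h4). Let h ∈ GL_{q+n}(ℝ) be a block upper-triangular map of the form h = [[h_q, A],[0, h_n]] with respect to the decomposition ℝ^{q+n} = ℝ^q ⊕ ℝ^n, where h_q ∈ GL_q(ℝ), h_n ∈ GL_n(ℝ) and A : ℝ^n → ℝ^q is linear, and assume that (a) h_nᵀ h_n commutes with ad_μ z|_{ℝ^n} for every z ∈ ℝ^q, and (b) A ∘ (ad_μ z|_{ℝ^n}) = h_q ∘ (ad_μ z|_{ℝ^q}) ∘ h_q⁻¹ ∘ A for every z ∈ ℝ^q. Then the bracket h.μ also satisfies conditions (h1), (h3) and (h4). -/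
open scoped BigOperators

noncomputable section

/-- Euclidean space `ℝ^m` as functions `Fin m → ℝ`. -/
abbrev Eu (m : ℕ) := Fin m → ℝ

/-- The space of bilinear maps `ℝ^{q+n} × ℝ^{q+n} → ℝ^{q+n}`. -/
abbrev Bil (q n : ℕ) := Eu (q + n) →ₗ[ℝ] Eu (q + n) →ₗ[ℝ] Eu (q + n)

/-- Skew-symmetry: membership in `V_{q+n}`. -/
def Skew (q n : ℕ) (μ : Bil q n) : Prop := ∀ x y, μ x y = - μ y x

/-- Membership in the `ℝ^q`-factor (first `q` coordinates). -/
def inK (q n : ℕ) (x : Eu (q + n)) : Prop := ∀ i : Fin (q + n), q ≤ (i : ℕ) → x i = 0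

/-- Membership in the `ℝ^n`-factor (last `n` coordinates). -/
def inP (q n : ℕ) (x : Eu (q + n)) : Prop := ∀ i : Fin (q + n), (i : ℕ) < q → x i = 0

/-- The canonical inner product. -/
def dotE (m : ℕ) (x y : Eu m) : ℝ := ∑ i, x i * y i

/-- Condition (h1): Jacobi identity, `μ(ℝ^q,ℝ^q) ⊆ ℝ^q` and `μ(ℝ^q,ℝ^n) ⊆ ℝ^n`. -/
def H1 (q n : ℕ) (μ : Bil q n) : Prop :=
  (∀ x y z, μ x (μ y z) + μ y (μ z x) + μ z (μ x y) = 0) ∧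
  (∀ x y, inK q n x → inK q n y → inK q n (μ x y)) ∧
  (∀ x y, inK q n x → inP q n y → inP q n (μ x y))

/-- Condition (h3): `ad_μ z|_{ℝ^n}` is skew-symmetric for every `z ∈ ℝ^q`. -/
def H3 (q n : ℕ) (μ : Bil q n) : Prop :=
  ∀ z x y, inK q n z → inP q n x → inP q n y →
    dotE (q + n) (μ z x) y = - dotE (q + n) x (μ z y)

/-- Condition (h4): almost-effectiveness. -/
def H4 (q n : ℕ) (μ : Bil q n) : Prop :=
  ∀ z, inK q n z → (∀ x, inP q n x → μ z x = 0) → z = 0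

/-- Inclusion `ℝ^q → ℝ^{q+n}` onto the first `q` coordinates. -/
def emK (q n : ℕ) : Eu q →ₗ[ℝ] Eu (q + n) where
  toFun z := fun i => if h : (i : ℕ) < q then z ⟨i, h⟩ else 0
  map_add' x y := by funext i; by_cases h : (i : ℕ) < q <;> simp [h]
  map_smul' c x := by funext i; by_cases h : (i : ℕ) < q <;> simp [h]

/-- Inclusion `ℝ^n → ℝ^{q+n}` onto the last `n` coordinates. -/
def emP (q n : ℕ) : Eu n →ₗ[ℝ] Eu (q + n) where
  toFun x := fun i => if h : q ≤ (i : ℕ) then x ⟨(i : ℕ) - q, by have := i.isLt; omega⟩ else 0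
  map_add' x y := by funext i; by_cases h : q ≤ (i : ℕ) <;> simp [h]
  map_smul' c x := by funext i; by_cases h : q ≤ (i : ℕ) <;> simp [h]

/-- Projection `ℝ^{q+n} → ℝ^q` (first `q` coordinates). -/
def prK (q n : ℕ) : Eu (q + n) →ₗ[ℝ] Eu q where
  toFun v := fun i => v ⟨(i : ℕ), by have := i.isLt; omega⟩
  map_add' x y := rfl
  map_smul' c x := rfl

/-- Projection `ℝ^{q+n} → ℝ^n` (last `n` coordinates). -/
def prP (q n : ℕ) : Eu (q + n) →ₗ[ℝ] Eu n where
  toFun v := fun i => v ⟨q + (i : ℕ), by have := i.isLt; omega⟩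
  map_add' x y := rfl
  map_smul' c x := rfl

/-- The restriction `ad_μ z|_{ℝ^n} : ℝ^n → ℝ^n` for `z ∈ ℝ^q`. -/
def restAdP (q n : ℕ) (μ : Bil q n) (z : Eu q) : Eu n →ₗ[ℝ] Eu n :=
  (prP q n) ∘ₗ (μ (emK q n z)) ∘ₗ (emP q n)

/-- The restriction `ad_μ z|_{ℝ^q} : ℝ^q → ℝ^q` for `z ∈ ℝ^q`. -/
def restAdK (q n : ℕ) (μ : Bil q n) (z : Eu q) : Eu q →ₗ[ℝ] Eu q :=
  (prK q n) ∘ₗ (μ (emK q n z)) ∘ₗ (emK q n)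

/-- Transpose of an endomorphism of `ℝ^n` with respect to the canonical basis. -/
def tmap (n : ℕ) (f : Eu n →ₗ[ℝ] Eu n) : Eu n →ₗ[ℝ] Eu n :=
  Matrix.toLin' (LinearMap.toMatrix' f).transpose

/-- The `GL_{q+n}(ℝ)`-action `(h.μ)(x,y) = h μ(h⁻¹x, h⁻¹y)` on brackets. -/
def act (q n : ℕ) (h : Eu (q + n) ≃ₗ[ℝ] Eu (q + n)) (μ : Bil q n) : Bil q n :=
  ((μ.comp h.symm.toLinearMap).compl₂ h.symm.toLinearMap).compr₂ h.toLinearMap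

lemma exists_emK_of_inK {q n : ℕ} {x : Eu (q + n)} (hx : inK q n x) : ∃ z, x = emK q n z := by
  refine ⟨prK q n x, ?_⟩
  funext i
  by_cases hi : (i : ℕ) < q
  · simp [emK, prK, hi]
  · simp [emK, hi, hx i (by omega)]

lemma exists_emP_of_inP {q n : ℕ} {x : Eu (q + n)} (hx : inP q n x) : ∃ p, x = emP q n p := by
  refine ⟨prP q n x, ?_⟩
  funext i
  by_cases hi : q ≤ (i : ℕ)
  · simp [emP, prP, hi]
  · simp [emP, hi, hx i (by omega)]

lemma inK_emK (q n : ℕ) (z : Eu q) : inK q n (emK q n z) := by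
  intro i hi
  simp [emK, Nat.not_lt.mpr hi]

lemma inP_emP (q n : ℕ) (p : Eu n) : inP q n (emP q n p) := by
  intro i hi
  simp [emP, Nat.not_le.mpr hi]

@[simp] lemma prK_emK (q n : ℕ) (z : Eu q) : prK q n (emK q n z) = z := by
  funext i
  simp [emK, prK]

@[simp] lemma prP_emP (q n : ℕ) (p : Eu n) : prP q n (emP q n p) = p := by
  funext i
  simp [emP, prP]

@[simp] lemma prK_emP (q n : ℕ) (p : Eu n) : prK q n (emP q n p) = 0 := by
  funext i
  simp [emP, prK]

@[simp] lemma prP_emK (q n : ℕ) (z : Eu q) : prP q n (emK q n z) = 0 := by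
  funext i
  simp [emK, prP]

lemma dotE_emP (q n : ℕ) (x y : Eu n) : dotE (q + n) (emP q n x) (emP q n y) = dotE n x y := by
  have hK : ∀ i : Fin q, emP q n x (Fin.castAdd n i) = 0 := fun i => inP_emP q n x _ i.isLt
  have hP : ∀ (p : Eu n) (i : Fin n), emP q n p (Fin.natAdd q i) = p i := fun p i =>
    congrFun (prP_emP q n p) i
  simp only [dotE, Fin.sum_univ_add, hK, hP, zero_mul, Finset.sum_const_zero, zero_add]

lemma dotE_tmap (n : ℕ) (f : Eu n →ₗ[ℝ] Eu n) (x y : Eu n) :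
    dotE n x (tmap n f y) = dotE n (f x) y := by
  have key := Matrix.dotProduct_mulVec x (LinearMap.toMatrix' f).transpose y
  rw [Matrix.vecMul_transpose, LinearMap.toMatrix'_mulVec] at key
  exact key

lemma mul_emK_emK {q n : ℕ} {μ : Bil q n} (h1 : H1 q n μ) (z w : Eu q) :
    μ (emK q n z) (emK q n w) = emK q n (restAdK q n μ z w) := by
  obtain ⟨v, hv⟩ := exists_emK_of_inK (h1.2.1 _ _ (inK_emK q n z) (inK_emK q n w))
  simp [restAdK, hv]

lemma mul_emK_emP {q n : ℕ} {μ : Bil q n} (h1 : H1 q n μ) (z : Eu q) (p : Eu n) :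
    μ (emK q n z) (emP q n p) = emP q n (restAdP q n μ z p) := by
  obtain ⟨v, hv⟩ := exists_emP_of_inP (h1.2.2 _ _ (inK_emK q n z) (inP_emP q n p))
  simp [restAdP, hv]

lemma dotE_restAdP {q n : ℕ} {μ : Bil q n} (h1 : H1 q n μ) (h3 : H3 q n μ) (z : Eu q)
    (x y : Eu n) : dotE n (restAdP q n μ z x) y = -dotE n x (restAdP q n μ z y) := by
  have key := h3 _ _ _ (inK_emK q n z) (inP_emP q n x) (inP_emP q n y)
  simpa only [mul_emK_emP h1, dotE_emP] using key

lemma act_apply (q n : ℕ) (h : Eu (q + n) ≃ₗ[ℝ] Eu (q + n)) (μ : Bil q n) (x y : Eu (q + n)) :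
    act q n h μ x y = h (μ (h.symm x) (h.symm y)) := rfl

lemma act_jacobi {q n : ℕ} {μ : Bil q n}
    (hμ : ∀ x y z, μ x (μ y z) + μ y (μ z x) + μ z (μ x y) = 0)
    (h : Eu (q + n) ≃ₗ[ℝ] Eu (q + n)) (x y z : Eu (q + n)) :
    act q n h μ x (act q n h μ y z) + act q n h μ y (act q n h μ z x)
      + act q n h μ z (act q n h μ x y) = 0 := by
  simp only [act_apply, LinearEquiv.symm_apply_apply, ← map_add, hμ, map_zero]

section BlockTriangular

variable {q n : ℕ} {μ : Bil q n} {h : Eu (q + n) ≃ₗ[ℝ] Eu (q + n)}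
  {hq : Eu q ≃ₗ[ℝ] Eu q} {hn : Eu n ≃ₗ[ℝ] Eu n} {A : Eu n →ₗ[ℝ] Eu q}

lemma blockTriangular_symm_emK
    (hform : ∀ x, h x = emK q n (hq (prK q n x) + A (prP q n x)) + emP q n (hn (prP q n x)))
    (z : Eu q) : h.symm (emK q n z) = emK q n (hq.symm z) := by
  rw [LinearEquiv.symm_apply_eq, hform]
  simp

lemma blockTriangular_symm_emP
    (hform : ∀ x, h x = emK q n (hq (prK q n x) + A (prP q n x)) + emP q n (hn (prP q n x)))
    (p : Eu n) :
    h.symm (emP q n p) = emP q n (hn.symm p) - emK q n (hq.symm (A (hn.symm p))) := by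
  rw [LinearEquiv.symm_apply_eq, hform]
  simp

lemma act_emK_emK (h1 : H1 q n μ)
    (hform : ∀ x, h x = emK q n (hq (prK q n x) + A (prP q n x)) + emP q n (hn (prP q n x)))
    (z w : Eu q) :
    act q n h μ (emK q n z) (emK q n w)
      = emK q n (hq (restAdK q n μ (hq.symm z) (hq.symm w))) := by
  rw [act_apply, blockTriangular_symm_emK hform, blockTriangular_symm_emK hform, mul_emK_emK h1,
    hform]
  simp

lemma act_emK_emP (h1 : H1 q n μ)
    (hform : ∀ x, h x = emK q n (hq (prK q n x) + A (prP q n x)) + emP q n (hn (prP q n x)))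
    (hb : ∀ z : Eu q,
      A ∘ₗ restAdP q n μ z
        = hq.toLinearMap ∘ₗ restAdK q n μ z ∘ₗ hq.symm.toLinearMap ∘ₗ A)
    (z : Eu q) (p : Eu n) :
    act q n h μ (emK q n z) (emP q n p)
      = emP q n (hn (restAdP q n μ (hq.symm z) (hn.symm p))) := by
  have hA : A (restAdP q n μ (hq.symm z) (hn.symm p))
      = hq (restAdK q n μ (hq.symm z) (hq.symm (A (hn.symm p)))) :=
    LinearMap.congr_fun (hb (hq.symm z)) (hn.symm p)
  rw [act_apply, blockTriangular_symm_emK hform, blockTriangular_symm_emP hform, map_sub,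
    mul_emK_emP h1, mul_emK_emK h1, hform]
  simp [hA]

end BlockTriangular

lemma dotE_conj_restAdP {q n : ℕ} {μ : Bil q n} (h1 : H1 q n μ) (h3 : H3 q n μ)
    {hn : Eu n ≃ₗ[ℝ] Eu n} {z : Eu q}
    (ha : (tmap n hn.toLinearMap ∘ₗ hn.toLinearMap) ∘ₗ restAdP q n μ z
        = restAdP q n μ z ∘ₗ (tmap n hn.toLinearMap ∘ₗ hn.toLinearMap))
    (x y : Eu n) :
    dotE n (hn (restAdP q n μ z (hn.symm x))) y
      = -dotE n x (hn (restAdP q n μ z (hn.symm y))) := by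
  have hcomm : tmap n hn.toLinearMap (hn (restAdP q n μ z (hn.symm y)))
      = restAdP q n μ z (tmap n hn.toLinearMap y) := by
    simpa using LinearMap.congr_fun ha (hn.symm y)
  calc dotE n (hn (restAdP q n μ z (hn.symm x))) y
      = dotE n (restAdP q n μ z (hn.symm x)) (tmap n hn.toLinearMap y) :=
        (dotE_tmap n hn.toLinearMap _ _).symm
    _ = -dotE n (hn.symm x) (tmap n hn.toLinearMap (hn (restAdP q n μ z (hn.symm y)))) := by
        rw [dotE_restAdP h1 h3, hcomm]
    _ = -dotE n x (hn (restAdP q n μ z (hn.symm y))) := by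
        rw [dotE_tmap]
        simp

/-- cf. Proposition 3.4 of the paper: conditions (h1), (h3), (h4) are
preserved by the action of block upper-triangular elements of `GL_{q+n}(ℝ)` satisfying the
compatibility conditions (a) and (b). -/
theorem h1_h3_h4_invariant_under_block_triangular
    (q n : ℕ) (μ : Bil q n) (hμ : Skew q n μ)
    (h1 : H1 q n μ) (h3 : H3 q n μ) (h4 : H4 q n μ)
    (h : Eu (q + n) ≃ₗ[ℝ] Eu (q + n))
    (hq : Eu q ≃ₗ[ℝ] Eu q) (hn : Eu n ≃ₗ[ℝ] Eu n) (A : Eu n →ₗ[ℝ] Eu q)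
    (hform : ∀ x, h x = emK q n (hq (prK q n x) + A (prP q n x)) + emP q n (hn (prP q n x)))
    (ha : ∀ z : Eu q,
      (tmap n hn.toLinearMap ∘ₗ hn.toLinearMap) ∘ₗ restAdP q n μ z
        = restAdP q n μ z ∘ₗ (tmap n hn.toLinearMap ∘ₗ hn.toLinearMap))
    (hb : ∀ z : Eu q,
      A ∘ₗ restAdP q n μ z
        = hq.toLinearMap ∘ₗ restAdK q n μ z ∘ₗ hq.symm.toLinearMap ∘ₗ A) :
    H1 q n (act q n h μ) ∧ H3 q n (act q n h μ) ∧ H4 q n (act q n h μ) := by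
  have hKK := act_emK_emK h1 hform
  have hKP := act_emK_emP h1 hform hb
  refine ⟨⟨act_jacobi h1.1 h, ?_, ?_⟩, ?_, ?_⟩
  · intro x y hx hy
    obtain ⟨z, rfl⟩ := exists_emK_of_inK hx
    obtain ⟨w, rfl⟩ := exists_emK_of_inK hy
    rw [hKK]
    exact inK_emK q n _
  · intro x y hx hy
    obtain ⟨z, rfl⟩ := exists_emK_of_inK hx
    obtain ⟨p, rfl⟩ := exists_emP_of_inP hy
    rw [hKP]
    exact inP_emP q n _
  · intro z x y hz hx hy
    obtain ⟨z, rfl⟩ := exists_emK_of_inK hz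
    obtain ⟨x, rfl⟩ := exists_emP_of_inP hx
    obtain ⟨y, rfl⟩ := exists_emP_of_inP hy
    rw [hKP, hKP, dotE_emP, dotE_emP]
    exact dotE_conj_restAdP h1 h3 (ha _) x y
  · intro z hz hzero
    obtain ⟨z, rfl⟩ := exists_emK_of_inK hz
    have hker : emK q n (hq.symm z) = 0 := by
      refine h4 _ (inK_emK q n _) fun x hx => ?_
      obtain ⟨p, rfl⟩ := exists_emP_of_inP hx
      have hp := congrArg (prP q n) (hzero _ (inP_emP q n (hn p)))
      rw [hKP, prP_emP, map_zero, LinearEquiv.symm_apply_apply,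
        LinearEquiv.map_eq_zero_iff] at hp
      rw [mul_emK_emP h1, hp, map_zero]
    have hz0 := congrArg (prK q n) hker
    rw [prK_emK, map_zero, LinearEquiv.map_eq_zero_iff] at hz0
    rw [hz0, map_zero]
end
end

section
/- Let q, n ≥ 0 and suppose μ ∈ V_{q+n} satisfies conditions (h1), (h3) and (h4). Let P_q : ℝ^{q+n} → ℝ^q denote the projection onto ℝ^q along ℝ^n, and define λ ∈ V_{q+n} by λ(u,v) := μ(P_q u, v) + μ(u, P_q v) − μ(P_q u, P_q v), i.e. λ agrees with μ whenever one argument lies in ℝ^q and λ vanishes on ℝ^n × ℝ^n. Then λ also satisfies conditions (h1), (h3) and (h4). -/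
open scoped BigOperators

noncomputable section

/-- The projection of `ℝ^{q+n}` onto the `ℝ^q`-factor along the `ℝ^n`-factor. -/
def PKproj (q n : ℕ) : Eu (q + n) →ₗ[ℝ] Eu (q + n) where
  toFun v := fun i => if (i : ℕ) < q then v i else 0
  map_add' x y := by funext i; by_cases h : (i : ℕ) < q <;> simp [h]
  map_smul' c x := by funext i; by_cases h : (i : ℕ) < q <;> simp [h]

theorem inK_PKproj (q n : ℕ) (v : Eu (q + n)) : inK q n (PKproj q n v) :=
  fun _ hi => if_neg (not_lt.mpr hi)

theorem inP_sub_PKproj (q n : ℕ) (v : Eu (q + n)) : inP q n (v - PKproj q n v) := by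
  intro i hi
  simp [PKproj, hi]

theorem PKproj_of_inK {q n : ℕ} {v : Eu (q + n)} (hv : inK q n v) : PKproj q n v = v := by
  funext i
  by_cases hi : (i : ℕ) < q
  · simp [PKproj, hi]
  · simp [PKproj, hi, hv i (not_lt.mp hi)]

theorem PKproj_of_inP {q n : ℕ} {v : Eu (q + n)} (hv : inP q n v) : PKproj q n v = 0 := by
  funext i
  by_cases hi : (i : ℕ) < q
  · simp [PKproj, hi, hv i hi]
  · simp [PKproj, hi]

/-- The `ℝ^q`-component of the flattened bracket is the bracket of the `ℝ^q`-components. -/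
theorem PKproj_flat {q n : ℕ} {μ : Bil q n} (hμ : Skew q n μ) (h1 : H1 q n μ)
    (u v : Eu (q + n)) :
    PKproj q n (μ (PKproj q n u) v + μ u (PKproj q n v) - μ (PKproj q n u) (PKproj q n v)) =
      μ (PKproj q n u) (PKproj q n v) := by
  have hK := PKproj_of_inK (h1.2.1 _ _ (inK_PKproj q n u) (inK_PKproj q n v))
  have hv := PKproj_of_inP (h1.2.2 _ _ (inK_PKproj q n u) (inP_sub_PKproj q n v))
  have hu := PKproj_of_inP (h1.2.2 _ _ (inK_PKproj q n v) (inP_sub_PKproj q n u))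
  rw [map_sub, map_sub, hK] at hv
  rw [map_sub, map_sub, hμ _ u, hμ _ (PKproj q n u), map_neg, map_neg, hK] at hu
  rw [map_sub, map_add, hK]
  linear_combination hv - hu

/-- the "flattening" `λ(u,v) = μ(P_q u, v) + μ(u, P_q v) − μ(P_q u, P_q v)`
of a bracket satisfying (h1), (h3), (h4) again satisfies (h1), (h3), (h4). -/
theorem flat_bracket_satisfies_h1_h3_h4
    (q n : ℕ) (μ : Bil q n) (hμ : Skew q n μ)
    (h1 : H1 q n μ) (h3 : H3 q n μ) (h4 : H4 q n μ) :
    H1 q n (μ.comp (PKproj q n) + μ.compl₂ (PKproj q n)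
        - (μ.comp (PKproj q n)).compl₂ (PKproj q n)) ∧
    H3 q n (μ.comp (PKproj q n) + μ.compl₂ (PKproj q n)
        - (μ.comp (PKproj q n)).compl₂ (PKproj q n)) ∧
    H4 q n (μ.comp (PKproj q n) + μ.compl₂ (PKproj q n)
        - (μ.comp (PKproj q n)).compl₂ (PKproj q n)) := by
  have flat : ∀ u v, (μ.comp (PKproj q n) + μ.compl₂ (PKproj q n)
      - (μ.comp (PKproj q n)).compl₂ (PKproj q n)) u v =
      μ (PKproj q n u) v + μ u (PKproj q n v) - μ (PKproj q n u) (PKproj q n v) :=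
    fun _ _ => rfl
  have flat_inK : ∀ z v, inK q n z → (μ.comp (PKproj q n) + μ.compl₂ (PKproj q n)
      - (μ.comp (PKproj q n)).compl₂ (PKproj q n)) z v = μ z v := by
    intro z v hz
    rw [flat, PKproj_of_inK hz, add_sub_cancel_right]
  refine ⟨⟨fun x y z => ?_, fun x y hx hy => ?_, fun x y hx hy => ?_⟩,
    fun z x y hz hx hy => ?_, fun z hz h => h4 z hz fun x hx => ?_⟩
  · have jac := h1.1
    have expand : ∀ u v w : Eu (q + n),
        μ (PKproj q n u) (μ (PKproj q n v) w + μ v (PKproj q n w)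
            - μ (PKproj q n v) (PKproj q n w))
          = μ (PKproj q n u) (μ (PKproj q n v) w) + μ (PKproj q n u) (μ v (PKproj q n w))
            - μ (PKproj q n u) (μ (PKproj q n v) (PKproj q n w)) :=
      fun u v w => by rw [map_sub, map_add]
    simp only [flat, PKproj_flat hμ h1, expand]
    linear_combination jac (PKproj q n x) (PKproj q n y) z
      + jac (PKproj q n x) y (PKproj q n z) + jac x (PKproj q n y) (PKproj q n z)
      - 2 * jac (PKproj q n x) (PKproj q n y) (PKproj q n z)
  · rw [flat_inK x y hx]
    exact h1.2.1 x y hx hy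
  · rw [flat_inK x y hx]
    exact h1.2.2 x y hx hy
  · rw [flat_inK z x hz, flat_inK z y hz]
    exact h3 z x y hz hx hy
  · rw [← flat_inK z x hz]
    exact h x hx
end
end

section
/- Let q, n ≥ 0. For μ ∈ V_{q+n} and x ∈ ℝ^{q+n}, the series F_μ(x) := Σ_{k≥0} ((−1)^k/(k+1)!) (ad_μ x)^k of endomorphisms of ℝ^{q+n} converges absolutely; let ι : ℝ^n → ℝ^{q+n} be the inclusion of the ℝ^n-factor, P : ℝ^{q+n} → ℝ^n the projection onto ℝ^n along ℝ^q, and define G_μ : ℝ^n → M_n(ℝ) by G_μ(x)_{ij} := ⟨P F_μ(ι x) e_{q+i}, P F_μ(ι x) e_{q+j}⟩ for 1 ≤ i,j ≤ n. Then each G_μ is a C^∞ (indeed real-analytic) map, and whenever a sequence μ_k converges to λ in V_{q+n}, for every nonnegative integer m and every compact subset K ⊂ ℝ^n the m-th iterated derivatives of G_{μ_k} converge uniformly on K to the m-th iterated derivatives of G_λ. -/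
open scoped BigOperators
open Filter

noncomputable section

/-- `V_{q+n}`: the space of (continuous) bilinear maps `ℝ^{q+n} × ℝ^{q+n} → ℝ^{q+n}`,
with its canonical finite-dimensional topology. -/
abbrev BilC (q n : ℕ) := Eu (q + n) →L[ℝ] Eu (q + n) →L[ℝ] Eu (q + n)

/-- Skew-symmetry: membership in `V_{q+n}`. -/
def SkewC (q n : ℕ) (μ : BilC q n) : Prop := ∀ x y, μ x y = - μ y x

/-- The inclusion `ι : ℝ^n → ℝ^{q+n}` of the `ℝ^n`-factor. -/
def iotaP (q n : ℕ) (y : Eu n) : Eu (q + n) :=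
  fun i => if h : q ≤ (i : ℕ) then y ⟨(i : ℕ) - q, by have := i.isLt; omega⟩ else 0

/-- The projection `P : ℝ^{q+n} → ℝ^n` onto the `ℝ^n`-factor along `ℝ^q`. -/
def projP (q n : ℕ) (v : Eu (q + n)) : Eu n :=
  fun i => v ⟨q + (i : ℕ), by have := i.isLt; omega⟩

/-- The basis vector `e_{q+i}` of the `ℝ^n`-factor of `ℝ^{q+n}`. -/
def ebP (q n : ℕ) (i : Fin n) : Eu (q + n) :=
  Pi.single ⟨q + (i : ℕ), by have := i.isLt; omega⟩ 1

/-- The coefficients `(−1)^k/(k+1)!` of the series `(I − e^{−ad x})/(ad x)`. -/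
def coeffF (k : ℕ) : ℝ := (-1) ^ k / (k + 1).factorial

/-- `F_μ(x) = Σ_{k≥0} ((−1)^k/(k+1)!) (ad_μ x)^k`. -/
def Fmap (q n : ℕ) (μ : BilC q n) (x : Eu (q + n)) : Eu (q + n) →L[ℝ] Eu (q + n) :=
  ∑' k : ℕ, coeffF k • (μ x) ^ k

/-- `G_μ : ℝ^n → M_n(ℝ)`, `G_μ(x)_{ij} = ⟨P F_μ(ι x) e_{q+i}, P F_μ(ι x) e_{q+j}⟩`:
the coordinate expression of the invariant metric in canonical coordinates. -/
def Gmap (q n : ℕ) (μ : BilC q n) (x : Eu n) : Fin n → Fin n → ℝ :=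
  fun i j => ∑ l, projP q n (Fmap q n μ (iotaP q n x) (ebP q n i)) l *
                  projP q n (Fmap q n μ (iotaP q n x) (ebP q n j)) l

/-- If `f : P × E → F` is smooth, then every iterated derivative of `f p` at `x` is smooth
in `(p, x)`. -/
theorem contDiff_iteratedFDeriv_of_uncurry {P E F : Type*}
    [NormedAddCommGroup P] [NormedSpace ℝ P] [NormedAddCommGroup E] [NormedSpace ℝ E]
    [NormedAddCommGroup F] [NormedSpace ℝ F] {f : P → E → F}
    (hf : ContDiff ℝ (⊤ : ℕ∞) (Function.uncurry f)) (m : ℕ) :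
    ContDiff ℝ (⊤ : ℕ∞) fun z : P × E => iteratedFDeriv ℝ m (f z.1) z.2 := by
  induction m with
  | zero =>
    simp only [iteratedFDeriv_zero_eq_comp, Function.comp_apply]
    exact (continuousMultilinearCurryFin0 ℝ E F).symm.contDiff.comp hf
  | succ m ih =>
    have h : ContDiff ℝ (⊤ : ℕ∞) (Function.uncurry
        fun (z : P × E) (x : E) => iteratedFDeriv ℝ m (f z.1) x) :=
      ih.comp ((contDiff_fst.comp contDiff_fst).prodMk contDiff_snd)
    have h' : ContDiff ℝ (⊤ : ℕ∞)
        fun z : P × E => fderiv ℝ (iteratedFDeriv ℝ m (f z.1)) z.2 :=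
      ContDiff.fderiv h contDiff_snd (by norm_cast)
    exact h'.continuousLinearMap_comp
      ((continuousMultilinearCurryLeftEquiv ℝ (fun _ : Fin (m + 1) => E) F).symm :
        _ →L[ℝ] E [×(m + 1)]→L[ℝ] F)

/-- If `f : P × E → F` is smooth, then `p ↦ f p` is continuous for the topology of uniform
convergence of all derivatives on compact sets. -/
theorem tendstoUniformlyOn_iteratedFDeriv_of_uncurry {ι P E F : Type*}
    [NormedAddCommGroup P] [NormedSpace ℝ P] [NormedAddCommGroup E] [NormedSpace ℝ E]
    [NormedAddCommGroup F] [NormedSpace ℝ F] {f : P → E → F}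
    (hf : ContDiff ℝ (⊤ : ℕ∞) (Function.uncurry f)) {l : Filter ι} {u : ι → P} {p : P}
    (hu : Tendsto u l (nhds p)) (m : ℕ) {K : Set E} (hK : IsCompact K) :
    TendstoUniformlyOn (fun k x => iteratedFDeriv ℝ m (f (u k)) x)
      (iteratedFDeriv ℝ m (f p)) l K := by
  intro U hU
  obtain ⟨v, hv, hvU⟩ := hK.mem_uniformity_of_prod (s := Set.univ) (q := p)
    (f := fun p x => iteratedFDeriv ℝ m (f p) x)
    (contDiff_iteratedFDeriv_of_uncurry hf m).continuous.continuousOn (Set.mem_univ p)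
    (symm_le_uniformity hU)
  rw [nhdsWithin_univ] at hv
  filter_upwards [hu hv] with k hk x hx using hvU _ hk x hx

theorem norm_coeffF (k : ℕ) : ‖coeffF k‖ = ((k + 1).factorial : ℝ)⁻¹ := by
  simp [coeffF]

theorem summable_norm_coeffF_smul_pow {A : Type*} [NormedRing A] [NormedAlgebra ℝ A] (T : A) :
    Summable fun k : ℕ => ‖coeffF k • T ^ k‖ := by
  refine Summable.of_nonneg_of_le (fun _ => norm_nonneg _) (fun k => ?_)
    (NormedSpace.norm_expSeries_summable' (𝕂 := ℝ) T)
  rw [norm_smul, norm_smul, norm_coeffF, norm_inv, RCLike.norm_natCast]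
  gcongr
  exact Nat.le_succ k

theorem analyticOnNhd_tsum_coeffF_smul_pow {A : Type*} [NormedRing A] [NormedAlgebra ℝ A]
    [CompleteSpace A] : AnalyticOnNhd ℝ (fun T : A => ∑' k : ℕ, coeffF k • T ^ k) Set.univ := by
  have hr : (FormalMultilinearSeries.ofScalars A coeffF).radius = ⊤ := by
    refine FormalMultilinearSeries.ofScalars_radius_eq_top_of_tendsto A _
      (Eventually.of_forall fun k => ?_) ?_
    · rw [← norm_ne_zero_iff, norm_coeffF]
      positivity
    · refine ((tendsto_add_atTop_iff_nat 2).2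
        (tendsto_inv_atTop_nhds_zero_nat (𝕜 := ℝ))).congr fun k => ?_
      rw [norm_coeffF, norm_coeffF, Nat.succ_eq_add_one, Nat.factorial_succ (k + 1)]
      push_cast
      field_simp
      ring
  have h := (FormalMultilinearSeries.ofScalars A coeffF).hasFPowerSeriesOnBall (by simp [hr])
  rw [hr] at h
  have h' := h.analyticOnNhd
  rw [Metric.eball_top] at h'
  have e : (FormalMultilinearSeries.ofScalars A coeffF).sum
      = fun T : A => ∑' k : ℕ, coeffF k • T ^ k :=
    FormalMultilinearSeries.ofScalarsSum_eq_tsum (E := A) coeffF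
  rwa [e] at h'

theorem contDiff_iotaP (q n : ℕ) {k : WithTop ℕ∞} : ContDiff ℝ k (iotaP q n) := by
  refine contDiff_pi.2 fun i => ?_
  unfold iotaP
  split_ifs with h
  · exact contDiff_apply ℝ ℝ _
  · exact contDiff_const

/-- `G_μ(x)` is real-analytic in `(μ, x)` jointly. -/
theorem contDiff_uncurry_Gmap (q n : ℕ) :
    ContDiff ℝ ⊤ (Function.uncurry (Gmap q n)) := by
  have hF : ContDiff ℝ ⊤ fun z : BilC q n × Eu n => Fmap q n z.1 (iotaP q n z.2) :=
    analyticOnNhd_tsum_coeffF_smul_pow.contDiff.comp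
      (contDiff_fst.clm_apply ((contDiff_iotaP q n).comp contDiff_snd))
  have hP : ∀ i l, ContDiff ℝ ⊤ fun z : BilC q n × Eu n =>
      projP q n (Fmap q n z.1 (iotaP q n z.2) (ebP q n i)) l := fun i l =>
    contDiff_pi.1 (hF.clm_apply contDiff_const) _
  refine contDiff_pi.2 fun i => contDiff_pi.2 fun j => ?_
  simp only [Function.uncurry_def, Gmap]
  exact ContDiff.sum fun l _ => (hP i l).mul (hP j l)

/-- cf. Proposition 6.8 and Corollary 6.9 of the paper: the series
defining `F_μ` converges absolutely, `G_μ` is smooth, and `μ ↦ G_μ` is continuous in the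
`C^∞`-topology: if `μ_k → λ` then all iterated derivatives of `G_{μ_k}` converge to those
of `G_λ` uniformly on compact sets. -/
theorem Gmap_smooth_and_continuous_in_mu (q n : ℕ) :
    (∀ μ : BilC q n, SkewC q n μ → ∀ x : Eu (q + n),
      Summable fun k : ℕ => ‖coeffF k • (μ x) ^ k‖) ∧
    (∀ μ : BilC q n, SkewC q n μ → ContDiff ℝ ⊤ (Gmap q n μ)) ∧
    (∀ (μs : ℕ → BilC q n) (lam : BilC q n),
      (∀ k, SkewC q n (μs k)) → SkewC q n lam →
      Tendsto μs atTop (nhds lam) →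
      ∀ (m : ℕ) (K : Set (Eu n)), IsCompact K →
        TendstoUniformlyOn (fun k x => iteratedFDeriv ℝ m (Gmap q n (μs k)) x)
          (iteratedFDeriv ℝ m (Gmap q n lam)) atTop K) := by
  refine ⟨?_, ?_, ?_⟩
  · intro μ _ x
    exact summable_norm_coeffF_smul_pow (A := Eu (q + n) →L[ℝ] Eu (q + n)) (μ x)
  · intro μ _
    have h : ContDiff ℝ ⊤ fun x : Eu n => (μ, x) := contDiff_const.prodMk contDiff_id
    have h2 : ContDiff ℝ ⊤ (Function.uncurry (Gmap q n) ∘ fun x : Eu n => (μ, x)) :=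
      (contDiff_uncurry_Gmap q n).comp h
    exact h2
  · intro μs lam _ _ hμ m K hK
    have h : ContDiff ℝ (⊤ : ℕ∞) (Function.uncurry (Gmap q n)) :=
      (contDiff_uncurry_Gmap q n).of_le le_top
    exact tendstoUniformlyOn_iteratedFDeriv_of_uncurry (f := Gmap q n) h hμ m hK
end
end

section
/- Let q, n ≥ 0 and μ ∈ V_{q+n}, and let G_μ : ℝ^n → M_n(ℝ) be defined by G_μ(x)_{ij} := ⟨P F_μ(ι x) e_{q+i}, P F_μ(ι x) e_{q+j}⟩, where F_μ(y) = Σ_{k≥0} ((−1)^k/(k+1)!) (ad_μ y)^k, ι : ℝ^n → ℝ^{q+n} is the inclusion and P : ℝ^{q+n} → ℝ^n the projection. Then G_μ(0) is the identity matrix, and for all 1 ≤ i, j, k ≤ n the partial derivative of the entry (G_μ)_{ij} at 0 in the k-th coordinate direction equals −(1/2)(⟨μ(e_{q+k}, e_{q+j}), e_{q+i}⟩ + ⟨μ(e_{q+k}, e_{q+i}), e_{q+j}⟩). -/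
open scoped BigOperators
open Filter

noncomputable section

namespace FormalMultilinearSeries

theorem hasFDerivAt_ofScalarsSum_zero {𝕜 E : Type*} [NontriviallyNormedField 𝕜] [NormedRing E]
    [NormedAlgebra 𝕜 E] [CompleteSpace E] {c : ℕ → 𝕜} (hc : 0 < (ofScalars E c).radius) :
    HasFDerivAt (ofScalarsSum c : E → E) (c 1 • ContinuousLinearMap.id 𝕜 E) 0 := by
  have h := ((ofScalars E c).hasFPowerSeriesOnBall hc).hasFPowerSeriesAt.hasFDerivAt
  convert! h using 1
  ext x
  simp [ofScalars]

end FormalMultilinearSeries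

theorem coeffF_ne_zero (k : ℕ) : coeffF k ≠ 0 :=
  div_ne_zero (pow_ne_zero _ (by norm_num)) (Nat.cast_ne_zero.mpr (Nat.factorial_ne_zero _))

theorem coeffF_ratio (k : ℕ) : ‖coeffF k.succ‖ / ‖coeffF k‖ = 1 / ((k + 1 : ℕ) + 1 : ℝ) := by
  have : ((k + 1).factorial : ℝ) ≠ 0 := Nat.cast_ne_zero.mpr (Nat.factorial_ne_zero _)
  have : ((k : ℝ) + 1 + 1) ≠ 0 := by positivity
  simp only [coeffF, norm_div, norm_pow, norm_neg, norm_one, one_pow, Real.norm_natCast,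
    Nat.succ_eq_add_one]
  rw [Nat.factorial_succ (k + 1)]
  push_cast
  field_simp

theorem radius_ofScalars_coeffF (E : Type*) [NormedRing E] [NormedAlgebra ℝ E] :
    (FormalMultilinearSeries.ofScalars E coeffF).radius = ⊤ := by
  apply FormalMultilinearSeries.ofScalars_radius_eq_top_of_tendsto E _
    (Eventually.of_forall coeffF_ne_zero)
  simp_rw [coeffF_ratio]
  exact (tendsto_add_atTop_iff_nat 1).mpr tendsto_one_div_add_atTop_nhds_zero_nat

theorem Fmap_eq_ofScalarsSum (q n : ℕ) (μ : BilC q n) (x : Eu (q + n)) :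
    Fmap q n μ x = FormalMultilinearSeries.ofScalarsSum coeffF (μ x) :=
  (FormalMultilinearSeries.ofScalars_sum_eq coeffF (μ x)).symm

theorem Fmap_zero (q n : ℕ) (μ : BilC q n) : Fmap q n μ 0 = 1 := by
  rw [Fmap_eq_ofScalarsSum, map_zero, FormalMultilinearSeries.ofScalarsSum_zero]
  simp [coeffF]

theorem hasFDerivAt_Fmap_zero (q n : ℕ) (μ : BilC q n) :
    HasFDerivAt (Fmap q n μ) ((-(1 / 2) : ℝ) • μ) 0 := by
  have h : HasFDerivAt (FormalMultilinearSeries.ofScalarsSum coeffF :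
      (Eu (q + n) →L[ℝ] Eu (q + n)) → _) (coeffF 1 • ContinuousLinearMap.id ℝ _) (μ 0) := by
    rw [map_zero]
    exact FormalMultilinearSeries.hasFDerivAt_ofScalarsSum_zero
      (by rw [radius_ofScalars_coeffF]; exact ENNReal.zero_lt_top)
  have h2 := h.comp (0 : Eu (q + n)) μ.hasFDerivAt
  have hF : Fmap q n μ = FormalMultilinearSeries.ofScalarsSum coeffF ∘ μ :=
    funext (Fmap_eq_ofScalarsSum q n μ)
  rw [hF]
  convert! h2 using 1
  ext x y m
  simp [coeffF]
  ring

/-- The inclusion `ι : ℝ^n → ℝ^{q+n}` as a continuous linear map. -/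
def iotaCLM (q n : ℕ) : Eu n →L[ℝ] Eu (q + n) :=
  LinearMap.toContinuousLinearMap
    { toFun := iotaP q n
      map_add' := fun x y => by
        ext i
        simp only [iotaP, Pi.add_apply]
        split_ifs <;> simp
      map_smul' := fun c x => by
        ext i
        simp only [iotaP, Pi.smul_apply, RingHom.id_apply]
        split_ifs <;> simp }

theorem iotaCLM_apply (q n : ℕ) (x : Eu n) : iotaCLM q n x = iotaP q n x := rfl

theorem iotaP_zero (q n : ℕ) : iotaP q n 0 = 0 := (iotaCLM q n).map_zero

theorem iotaP_single (q n : ℕ) (k : Fin n) : iotaP q n (Pi.single k 1) = ebP q n k := by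
  ext i
  simp only [iotaP, ebP, Pi.single_apply, Fin.ext_iff]
  split_ifs <;> first | rfl | omega

theorem projP_ebP (q n : ℕ) (i l : Fin n) :
    projP q n (ebP q n i) l = if l = i then 1 else 0 := by
  simp [projP, ebP, Pi.single_apply, Fin.ext_iff]

theorem sum_mul_ebP (q n : ℕ) (v : Eu (q + n)) (i : Fin n) :
    ∑ l, v l * ebP q n i l = projP q n v i := by
  simp [projP, ebP, Pi.single_apply]

theorem hasFDerivAt_projP_Fmap_iotaP_zero (q n : ℕ) (μ : BilC q n) (v : Eu (q + n)) (l : Fin n) :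
    ∃ D : Eu n →L[ℝ] ℝ,
      HasFDerivAt (fun x => projP q n (Fmap q n μ (iotaP q n x) v) l) D 0 ∧
      ∀ h, D h = -(1 / 2) * projP q n (μ (iotaP q n h) v) l := by
  have hF : HasFDerivAt (Fmap q n μ) ((-(1 / 2) : ℝ) • μ) (iotaCLM q n 0) := by
    rw [map_zero]
    exact hasFDerivAt_Fmap_zero q n μ
  let L : (Eu (q + n) →L[ℝ] Eu (q + n)) →L[ℝ] ℝ :=
    (ContinuousLinearMap.proj (R := ℝ) (φ := fun _ : Fin (q + n) => ℝ)
      ⟨q + (l : ℕ), by have := l.isLt; omega⟩).comp (ContinuousLinearMap.apply ℝ (Eu (q + n)) v)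
  exact ⟨_, L.hasFDerivAt.comp (0 : Eu n) (hF.comp (0 : Eu n) (iotaCLM q n).hasFDerivAt),
    fun h => by simp [L, projP, iotaCLM_apply]⟩

/-- the lower-order terms in Proposition 6.8 of the paper: `G_μ(0) = I`
and `∂_k (G_μ)_{ij}(0) = −(1/2)(⟨μ(e_{q+k},e_{q+j}), e_{q+i}⟩ + ⟨μ(e_{q+k},e_{q+i}), e_{q+j}⟩)`. -/
theorem Gmap_zero_and_first_derivative
    (q n : ℕ) (μ : BilC q n) (hμ : SkewC q n μ) :
    (∀ i j : Fin n, Gmap q n μ 0 i j = if i = j then (1 : ℝ) else 0) ∧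
    (∀ i j k : Fin n,
      fderiv ℝ (fun x => Gmap q n μ x i j) 0 (Pi.single k 1) =
        -(1/2) * ((∑ l, μ (ebP q n k) (ebP q n j) l * ebP q n i l)
                 + (∑ l, μ (ebP q n k) (ebP q n i) l * ebP q n j l))) := by
  refine ⟨fun i j => ?_, fun i j k => ?_⟩
  · simp [Gmap, iotaP_zero, Fmap_zero, projP_ebP, eq_comm]
  · choose D hD hDv using hasFDerivAt_projP_Fmap_iotaP_zero q n μ
    have hG : HasFDerivAt (fun x => Gmap q n μ x i j) _ 0 :=
      HasFDerivAt.fun_sum (u := Finset.univ)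
        fun l _ => (hD (ebP q n i) l).mul (hD (ebP q n j) l)
    rw [hG.fderiv]
    simp only [iotaP_zero, Fmap_zero, one_apply_eq_self, projP_ebP,
      sum_apply, add_apply, smul_apply, hDv, iotaP_single, sum_mul_ebP, smul_eq_mul,
      Finset.sum_add_distrib, ite_mul, one_mul, zero_mul, Finset.sum_ite_eq', Finset.mem_univ,
      if_true]
    ring
end
end

section
/- For real numbers a, b, c with a > 0, b > 0 and c < 0, the Lie algebra (ℝ^3, μ_{a,b,c}), where μ_{a,b,c} is the skew-symmetric bilinear bracket on ℝ^3 defined by μ(e_2,e_3) = a e_1, μ(e_3,e_1) = b e_2, μ(e_1,e_2) = c e_3, is isomorphic as a real Lie algebra to sl(2,ℝ), the Lie algebra of traceless 2×2 real matrices with the commutator bracket. -/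
noncomputable section

/-- The bracket `μ_{a,b,c}` on `ℝ³`: `μ(e₂,e₃)=a e₁`, `μ(e₃,e₁)=b e₂`, `μ(e₁,e₂)=c e₃`
(written with 0-indexed coordinates). -/
def muABC (a b c : ℝ) (x y : Fin 3 → ℝ) : Fin 3 → ℝ :=
  ![a * (x 1 * y 2 - x 2 * y 1),
    b * (x 2 * y 0 - x 0 * y 2),
    c * (x 0 * y 1 - x 1 * y 0)]

/-- The isomorphism `(ℝ³, μ_{p²,q²,-r²}) → sl(2,ℝ)`, viewed as a map into `2 × 2` matrices. -/
def muABCToMatrix (p q r : ℝ) : (Fin 3 → ℝ) →ₗ[ℝ] Matrix (Fin 2) (Fin 2) ℝ where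
  toFun x :=
    !![q * r * x 0 / 2, (p * r * x 1 - p * q * x 2) / 2;
      (p * r * x 1 + p * q * x 2) / 2, -(q * r * x 0) / 2]
  map_add' x y := by
    ext i j
    fin_cases i <;> fin_cases j <;> simp <;> ring
  map_smul' t x := by
    ext i j
    fin_cases i <;> fin_cases j <;> simp <;> ring

theorem muABCToMatrix_apply (p q r : ℝ) (x : Fin 3 → ℝ) :
    muABCToMatrix p q r x =
      !![q * r * x 0 / 2, (p * r * x 1 - p * q * x 2) / 2;
        (p * r * x 1 + p * q * x 2) / 2, -(q * r * x 0) / 2] :=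
  rfl

theorem muABCToMatrix_muABC (p q r : ℝ) (x y : Fin 3 → ℝ) :
    muABCToMatrix p q r (muABC (p ^ 2) (q ^ 2) (-r ^ 2) x y) =
      muABCToMatrix p q r x * muABCToMatrix p q r y -
        muABCToMatrix p q r y * muABCToMatrix p q r x := by
  ext i j
  fin_cases i <;> fin_cases j <;>
    simp [muABCToMatrix_apply, muABC] <;> ring

theorem muABCToMatrix_injective {p q r : ℝ} (hp : p ≠ 0) (hq : q ≠ 0) (hr : r ≠ 0) :
    Function.Injective (muABCToMatrix p q r) := by
  intro x y h
  have h00 := congrFun (congrFun h 0) 0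
  have h01 := congrFun (congrFun h 0) 1
  have h10 := congrFun (congrFun h 1) 0
  simp only [muABCToMatrix_apply, Matrix.of_apply, Matrix.cons_val] at h00 h01 h10
  have h0 : x 0 = y 0 := mul_left_cancel₀ (mul_ne_zero hq hr) (by linarith)
  have h1 : x 1 = y 1 := mul_left_cancel₀ (mul_ne_zero hp hr) (by linarith)
  have h2 : x 2 = y 2 := mul_left_cancel₀ (mul_ne_zero hp hq) (by linarith)
  ext i
  fin_cases i
  · exact h0
  · exact h1
  · exact h2

theorem range_muABCToMatrix {p q r : ℝ} (hp : p ≠ 0) (hq : q ≠ 0) (hr : r ≠ 0) :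
    Set.range (muABCToMatrix p q r) = { A : Matrix (Fin 2) (Fin 2) ℝ | A.trace = 0 } := by
  ext A
  simp only [Set.mem_range, Set.mem_ofPred_eq]
  constructor
  · rintro ⟨x, rfl⟩
    simp only [muABCToMatrix_apply, Matrix.trace_fin_two_of]
    ring
  · intro hA
    rw [Matrix.trace_fin_two] at hA
    refine ⟨![2 * A 0 0 / (q * r), (A 0 1 + A 1 0) / (p * r), (A 1 0 - A 0 1) / (p * q)], ?_⟩
    ext i j
    fin_cases i <;> fin_cases j <;> simp [muABCToMatrix_apply] <;> field_simp <;> linarith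

/-- cf. Example 3.2 of the paper: for `a, b > 0 > c`, the Lie algebra
`(ℝ³, μ_{a,b,c})` is isomorphic to `sl(2,ℝ)`. -/
theorem muABC_sl2 (a b c : ℝ) (ha : 0 < a) (hb : 0 < b) (hc : c < 0) :
    ∃ φ : (Fin 3 → ℝ) →ₗ[ℝ] Matrix (Fin 2) (Fin 2) ℝ,
      Function.Injective φ ∧
      (∀ x y, φ (muABC a b c x y) = φ x * φ y - φ y * φ x) ∧
      Set.range φ = { A : Matrix (Fin 2) (Fin 2) ℝ | A.trace = 0 } := by
  have hc' : 0 < -c := neg_pos.mpr hc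
  have hp := (Real.sqrt_pos.mpr ha).ne'
  have hq := (Real.sqrt_pos.mpr hb).ne'
  have hr := (Real.sqrt_pos.mpr hc').ne'
  refine ⟨muABCToMatrix √a √b √(-c), muABCToMatrix_injective hp hq hr, fun x y => ?_,
    range_muABCToMatrix hp hq hr⟩
  have h := muABCToMatrix_muABC √a √b √(-c) x y
  rwa [Real.sq_sqrt ha.le, Real.sq_sqrt hb.le, Real.sq_sqrt hc'.le, neg_neg] at h
end
end

section
/- For real numbers p, q, a, b, c, d, e, f, let μ be the skew-symmetric bilinear bracket on ℝ^6 with standard basis e_0, e_1, …, e_5 defined by: μ(e_0,e_2) = p e_3, μ(e_0,e_3) = −p e_2, μ(e_0,e_4) = q e_5, μ(e_0,e_5) = −q e_4, μ(e_1,e_2) = e e_3, μ(e_1,e_3) = −e e_2, μ(e_1,e_4) = f e_5, μ(e_1,e_5) = −f e_4, μ(e_2,e_3) = a e_0 + b e_1, μ(e_4,e_5) = c e_0 + d e_1, and μ(e_i,e_j) = 0 for all other pairs i < j. Then μ satisfies the Jacobi identity if and only if a q + b f = 0 and c p + d e = 0. -/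
noncomputable section

/-- The bracket `μ_{p,q,a,b,c,d,e,f}` on `ℝ⁶` of Example 3.3 of the paper, written
componentwise in the standard basis `e₀, …, e₅`. -/
def mu6 (p q a b c d e f : ℝ) (x y : Fin 6 → ℝ) : Fin 6 → ℝ :=
  ![a * (x 2 * y 3 - x 3 * y 2) + c * (x 4 * y 5 - x 5 * y 4),
    b * (x 2 * y 3 - x 3 * y 2) + d * (x 4 * y 5 - x 5 * y 4),
    -(p * (x 0 * y 3 - x 3 * y 0)) - e * (x 1 * y 3 - x 3 * y 1),
    p * (x 0 * y 2 - x 2 * y 0) + e * (x 1 * y 2 - x 2 * y 1),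
    -(q * (x 0 * y 5 - x 5 * y 0)) - f * (x 1 * y 5 - x 5 * y 1),
    q * (x 0 * y 4 - x 4 * y 0) + f * (x 1 * y 4 - x 4 * y 1)]

/-- cf. Example 3.3 of the paper: `μ_{p,q,a,b,c,d,e,f}` satisfies the
Jacobi identity if and only if `aq + bf = 0` and `cp + de = 0`. -/
theorem mu6_jacobi_iff (p q a b c d e f : ℝ) :
    (∀ x y z : Fin 6 → ℝ,
      mu6 p q a b c d e f x (mu6 p q a b c d e f y z)
        + mu6 p q a b c d e f y (mu6 p q a b c d e f z x)
        + mu6 p q a b c d e f z (mu6 p q a b c d e f x y) = 0)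
    ↔ (a * q + b * f = 0 ∧ c * p + d * e = 0) := by
  constructor
  · intro h
    constructor
    · have h₄ := congrFun (h ![0, 0, 0, 0, 0, 1] ![0, 0, 1, 0, 0, 0] ![0, 0, 0, 1, 0, 0]) 4
      simp [mu6] at h₄
      linear_combination h₄
    · have h₂ := congrFun (h ![0, 0, 0, 1, 0, 0] ![0, 0, 0, 0, 1, 0] ![0, 0, 0, 0, 0, 1]) 2
      simp [mu6] at h₂
      linear_combination h₂
  · rintro ⟨h₁, h₂⟩ x y z
    ext i
    fin_cases i <;> simp [mu6]
    · ring
    · ring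
    · linear_combination (x 3 * (y 4 * z 5 - y 5 * z 4) + y 3 * (z 4 * x 5 - z 5 * x 4)
        + z 3 * (x 4 * y 5 - x 5 * y 4)) * h₂
    · linear_combination -(x 2 * (y 4 * z 5 - y 5 * z 4) + y 2 * (z 4 * x 5 - z 5 * x 4)
        + z 2 * (x 4 * y 5 - x 5 * y 4)) * h₂
    · linear_combination (x 5 * (y 2 * z 3 - y 3 * z 2) + y 5 * (z 2 * x 3 - z 3 * x 2)
        + z 5 * (x 2 * y 3 - x 3 * y 2)) * h₁
    · linear_combination -(x 4 * (y 2 * z 3 - y 3 * z 2) + y 4 * (z 2 * x 3 - z 3 * x 2)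
        + z 4 * (x 2 * y 3 - x 3 * y 2)) * h₁
end
end

section
/- For real numbers a, b, c, d, let μ_{a,b,c,d} be the skew-symmetric bilinear bracket on ℝ^4 with standard basis e_0, e_1, e_2, e_3 defined by: μ(e_3,e_0) = d e_2, μ(e_0,e_2) = d e_3, μ(e_2,e_3) = a e_1 + b e_0, μ(e_3,e_1) = c e_2, μ(e_1,e_2) = c e_3, and μ(e_0,e_1) = 0. Then μ_{a,b,c,d} satisfies the Jacobi identity for all a, b, c, d, so (ℝ^4, μ_{a,b,c,d}) is a Lie algebra; moreover, if a c + b d < 0, it is isomorphic as a real Lie algebra to the product Lie algebra ℝ × sl(2,ℝ), and if a c + b d > 0, it is isomorphic to the product Lie algebra ℝ × so(3,ℝ). -/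
noncomputable section

/-- The bracket `μ_{a,b,c,d}` on `ℝ⁴` of Example 3.3 of the paper:
`μ(e₃,e₀)=d e₂`, `μ(e₀,e₂)=d e₃`, `μ(e₂,e₃)=a e₁ + b e₀`, `μ(e₃,e₁)=c e₂`,
`μ(e₁,e₂)=c e₃`, `μ(e₀,e₁)=0`, written componentwise. -/
def mu4 (a b c d : ℝ) (x y : Fin 4 → ℝ) : Fin 4 → ℝ :=
  ![b * (x 2 * y 3 - x 3 * y 2),
    a * (x 2 * y 3 - x 3 * y 2),
    -(d * (x 0 * y 3 - x 3 * y 0)) - c * (x 1 * y 3 - x 3 * y 1),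
    d * (x 0 * y 2 - x 2 * y 0) + c * (x 1 * y 2 - x 2 * y 1)]

theorem mu4_jacobi (a b c d : ℝ) (x y z : Fin 4 → ℝ) :
    mu4 a b c d x (mu4 a b c d y z) + mu4 a b c d y (mu4 a b c d z x)
      + mu4 a b c d z (mu4 a b c d x y) = 0 := by
  ext i
  fin_cases i <;> simp [mu4] <;> ring

/-- The functionals `a x₀ - b x₁` (which vanishes on brackets) and `d x₀ + c x₁` are coordinates
on the plane of `e₀` and `e₁` as soon as `ac + bd ≠ 0`. -/
theorem eq_of_center_coords {a b c d : ℝ} (hk : a * c + b * d ≠ 0) {x y : Fin 4 → ℝ}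
    (ht : a * x 0 - b * x 1 = a * y 0 - b * y 1) (hu : d * x 0 + c * x 1 = d * y 0 + c * y 1)
    (h2 : x 2 = y 2) (h3 : x 3 = y 3) : x = y := by
  have h0 : x 0 = y 0 := mul_left_cancel₀ hk (by linear_combination c * ht + b * hu)
  have h1 : x 1 = y 1 := mul_left_cancel₀ hk (by linear_combination a * hu - d * ht)
  ext i
  fin_cases i <;> assumption

theorem exists_center_coords {a b c d s : ℝ} (hk : a * c + b * d ≠ 0) (hs : s ≠ 0)
    (t u p q : ℝ) : ∃ x : Fin 4 → ℝ,
      a * x 0 - b * x 1 = t ∧ d * x 0 + c * x 1 = u ∧ s * x 2 = p ∧ s * x 3 = q := by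
  refine ⟨![(c * t + b * u) / (a * c + b * d), (a * u - d * t) / (a * c + b * d), p / s, q / s],
    ?_, ?_, ?_, ?_⟩ <;> simp
  · linear_combination t * mul_inv_cancel₀ hk
  · linear_combination u * mul_inv_cancel₀ hk
  · field_simp
  · field_simp

/-- The map to `ℝ × sl(2, ℝ)`, an isomorphism when `s ^ 2 = -(ac + bd) > 0`. -/
def toSl2 (a b c d s : ℝ) : (Fin 4 → ℝ) →ₗ[ℝ] ℝ × Matrix (Fin 2) (Fin 2) ℝ where
  toFun x := (a * x 0 - b * x 1,
    !![s * x 2 / 2, (s * x 3 - (d * x 0 + c * x 1)) / 2;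
      (s * x 3 + (d * x 0 + c * x 1)) / 2, -(s * x 2) / 2])
  map_add' x y := by
    ext i j
    · simp; ring
    · fin_cases i <;> fin_cases j <;> simp <;> ring
  map_smul' r x := by
    ext i j
    · simp; ring
    · fin_cases i <;> fin_cases j <;> simp <;> ring

/-- The map to `ℝ × so(3, ℝ)`, an isomorphism when `s ^ 2 = ac + bd > 0`. -/
def toSo3 (a b c d s : ℝ) : (Fin 4 → ℝ) →ₗ[ℝ] ℝ × Matrix (Fin 3) (Fin 3) ℝ where
  toFun x := (a * x 0 - b * x 1,
    !![0, -(s * x 3), s * x 2;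
      s * x 3, 0, -(d * x 0 + c * x 1);
      -(s * x 2), d * x 0 + c * x 1, 0])
  map_add' x y := by
    ext i j
    · simp; ring
    · fin_cases i <;> fin_cases j <;> simp <;> ring
  map_smul' r x := by
    ext i j
    · simp; ring
    · fin_cases i <;> fin_cases j <;> simp <;> ring

theorem toSl2_apply (a b c d s : ℝ) (x : Fin 4 → ℝ) :
    toSl2 a b c d s x = (a * x 0 - b * x 1,
      !![s * x 2 / 2, (s * x 3 - (d * x 0 + c * x 1)) / 2;
        (s * x 3 + (d * x 0 + c * x 1)) / 2, -(s * x 2) / 2]) := rfl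

theorem toSo3_apply (a b c d s : ℝ) (x : Fin 4 → ℝ) :
    toSo3 a b c d s x = (a * x 0 - b * x 1,
      !![0, -(s * x 3), s * x 2;
        s * x 3, 0, -(d * x 0 + c * x 1);
        -(s * x 2), d * x 0 + c * x 1, 0]) := rfl

theorem toSl2_injective {a b c d s : ℝ} (hk : a * c + b * d ≠ 0) (hs : s ≠ 0) :
    Function.Injective (toSl2 a b c d s) := by
  intro x y h
  rw [toSl2_apply, toSl2_apply, Prod.mk.injEq] at h
  obtain ⟨ht, h⟩ := h
  have h00 := congrFun₂ h 0 0
  have h01 := congrFun₂ h 0 1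
  have h10 := congrFun₂ h 1 0
  simp only [Matrix.of_apply, Matrix.cons_val', Matrix.cons_val_zero, Matrix.cons_val_one,
    Matrix.cons_val_fin_one] at h00 h01 h10
  exact eq_of_center_coords hk ht (by linear_combination h10 - h01)
    (mul_left_cancel₀ hs (by linear_combination 2 * h00))
    (mul_left_cancel₀ hs (by linear_combination h10 + h01))

theorem toSo3_injective {a b c d s : ℝ} (hk : a * c + b * d ≠ 0) (hs : s ≠ 0) :
    Function.Injective (toSo3 a b c d s) := by
  intro x y h
  rw [toSo3_apply, toSo3_apply, Prod.mk.injEq] at h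
  obtain ⟨ht, h⟩ := h
  exact eq_of_center_coords hk ht (congrFun₂ h 2 1)
    (mul_left_cancel₀ hs (congrFun₂ h 0 2)) (mul_left_cancel₀ hs (congrFun₂ h 1 0))

theorem toSl2_mu4 {a b c d s : ℝ} (hs : s ^ 2 = -(a * c + b * d)) (x y : Fin 4 → ℝ) :
    toSl2 a b c d s (mu4 a b c d x y) =
      (0, (toSl2 a b c d s x).2 * (toSl2 a b c d s y).2
        - (toSl2 a b c d s y).2 * (toSl2 a b c d s x).2) := by
  simp only [toSl2_apply]
  ext i j
  · simp [mu4]; ring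
  · fin_cases i <;> fin_cases j <;> simp [mu4]
    · ring
    · linear_combination (-(x 2 * y 3 - x 3 * y 2) / 2) * hs
    · linear_combination ((x 2 * y 3 - x 3 * y 2) / 2) * hs
    · ring

theorem toSo3_mu4 {a b c d s : ℝ} (hs : s ^ 2 = a * c + b * d) (x y : Fin 4 → ℝ) :
    toSo3 a b c d s (mu4 a b c d x y) =
      (0, (toSo3 a b c d s x).2 * (toSo3 a b c d s y).2
        - (toSo3 a b c d s y).2 * (toSo3 a b c d s x).2) := by
  simp only [toSo3_apply]
  ext i j
  · simp [mu4]; ring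
  · fin_cases i <;> fin_cases j <;> simp [mu4] <;>
      first
      | ring1
      | linear_combination (x 2 * y 3 - x 3 * y 2) * hs
      | linear_combination (-(x 2 * y 3 - x 3 * y 2)) * hs

theorem range_toSl2 {a b c d s : ℝ} (hk : a * c + b * d ≠ 0) (hs : s ≠ 0) :
    Set.range (toSl2 a b c d s) = {v | v.2.trace = 0} := by
  ext ⟨t, M⟩
  simp only [Set.mem_range, Set.mem_ofPred_eq, toSl2_apply, Prod.mk.injEq]
  constructor
  · rintro ⟨x, -, rfl⟩
    simp [Matrix.trace_fin_two]
    ring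
  · intro hM
    rw [Matrix.trace_fin_two] at hM
    obtain ⟨x, ht, hu, hp, hq⟩ := exists_center_coords hk hs t (M 1 0 - M 0 1) (2 * M 0 0)
      (M 0 1 + M 1 0)
    refine ⟨x, ht, ?_⟩
    rw [hu, hp, hq]
    ext i j
    fin_cases i <;> fin_cases j <;> simp <;> linarith

theorem range_toSo3 {a b c d s : ℝ} (hk : a * c + b * d ≠ 0) (hs : s ≠ 0) :
    Set.range (toSo3 a b c d s) = {v | v.2.transpose = -v.2} := by
  ext ⟨t, M⟩
  simp only [Set.mem_range, Set.mem_ofPred_eq, toSo3_apply, Prod.mk.injEq]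
  constructor
  · rintro ⟨x, -, rfl⟩
    ext i j
    fin_cases i <;> fin_cases j <;> simp
  · intro hM
    have hM' (i j : Fin 3) : M j i = -M i j := congrFun₂ hM i j
    obtain ⟨x, ht, hu, hp, hq⟩ := exists_center_coords hk hs t (M 2 1) (M 0 2) (M 1 0)
    refine ⟨x, ht, ?_⟩
    rw [hu, hp, hq]
    ext i j
    fin_cases i <;> fin_cases j <;> simp <;>
      linarith [hM' 0 0, hM' 1 1, hM' 2 2, hM' 0 1, hM' 0 2, hM' 1 2]

/-- cf. Example 3.3 of the paper: `μ_{a,b,c,d}` always satisfies the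
Jacobi identity; if `ac + bd < 0` then `(ℝ⁴, μ_{a,b,c,d}) ≅ ℝ × sl(2,ℝ)`, and if
`ac + bd > 0` then `(ℝ⁴, μ_{a,b,c,d}) ≅ ℝ × so(3,ℝ)`. -/
theorem mu4_jacobi_and_iso (a b c d : ℝ) :
    (∀ x y z : Fin 4 → ℝ,
      mu4 a b c d x (mu4 a b c d y z) + mu4 a b c d y (mu4 a b c d z x)
        + mu4 a b c d z (mu4 a b c d x y) = 0) ∧
    (a * c + b * d < 0 →
      ∃ φ : (Fin 4 → ℝ) →ₗ[ℝ] ℝ × Matrix (Fin 2) (Fin 2) ℝ,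
        Function.Injective φ ∧
        (∀ x y, φ (mu4 a b c d x y)
          = (0, (φ x).2 * (φ y).2 - (φ y).2 * (φ x).2)) ∧
        Set.range φ = { v : ℝ × Matrix (Fin 2) (Fin 2) ℝ | v.2.trace = 0 }) ∧
    (0 < a * c + b * d →
      ∃ φ : (Fin 4 → ℝ) →ₗ[ℝ] ℝ × Matrix (Fin 3) (Fin 3) ℝ,
        Function.Injective φ ∧
        (∀ x y, φ (mu4 a b c d x y)
          = (0, (φ x).2 * (φ y).2 - (φ y).2 * (φ x).2)) ∧
        Set.range φ = { v : ℝ × Matrix (Fin 3) (Fin 3) ℝ | v.2.transpose = -v.2 }) := by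
  refine ⟨mu4_jacobi a b c d, fun hk => ?_, fun hk => ?_⟩
  · have hs : √(-(a * c + b * d)) ≠ 0 := (Real.sqrt_pos.mpr (neg_pos.mpr hk)).ne'
    exact ⟨toSl2 a b c d √(-(a * c + b * d)), toSl2_injective hk.ne hs,
      toSl2_mu4 (Real.sq_sqrt (neg_pos.mpr hk).le), range_toSl2 hk.ne hs⟩
  · have hs : √(a * c + b * d) ≠ 0 := (Real.sqrt_pos.mpr hk).ne'
    exact ⟨toSo3 a b c d √(a * c + b * d), toSo3_injective hk.ne' hs,
      toSo3_mu4 (Real.sq_sqrt hk.le), range_toSo3 hk.ne' hs⟩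
end
end
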